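/- arXiv:1603.07437 — 2 statements merged into one kernel-verified Lean document; each statement's English description precedes it below -/
import Mathlib

section
/- Let (g, ρ, V, 𝒱, B₀) be a standard pentad with ρ faithful. Then (g, ρ, V, 𝒱, B₀) is irreducible if and only if the associated graded Lie algebra L(g,ρ,V,𝒱,B₀) has no nonzero proper graded ideal. -/
/-- A **standard pentad** `(g, ρ, V, 𝒱, B₀)` in the abstract-dual formulation: a Lie algebra
`g` with a non-degenerate invariant bilinear form `B`, representations `ρ` on `V` and `ϱ`
on `W` (with `W` playing the role of the `g`-submodule `𝒱 ⊆ Hom(V, k)`, realized via the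
non-degenerate pairing `pair`, so that `ϱ` is the canonical dual action), together with a
Φ-map `Φ`. -/
structure PentadStruct (k g V W : Type*) [Field k] [LieRing g] [LieAlgebra k g]
    [AddCommGroup V] [Module k V] [AddCommGroup W] [Module k W] where
  ρ : g →ₗ[k] V →ₗ[k] V
  rep_ρ : ∀ a b : g, ρ ⁅a, b⁆ = ρ a ∘ₗ ρ b - ρ b ∘ₗ ρ a
  ϱ : g →ₗ[k] W →ₗ[k] W
  rep_ϱ : ∀ a b : g, ϱ ⁅a, b⁆ = ϱ a ∘ₗ ϱ b - ϱ b ∘ₗ ϱ a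
  pair : V →ₗ[k] W →ₗ[k] k
  pair_compat : ∀ (a : g) (v : V) (w : W), pair (ρ a v) w = - pair v (ϱ a w)
  pair_nondeg_left : ∀ v : V, (∀ w : W, pair v w = 0) → v = 0
  pair_nondeg_right : ∀ w : W, (∀ v : V, pair v w = 0) → w = 0
  B : g →ₗ[k] g →ₗ[k] k
  B_nondeg_left : ∀ a : g, (∀ b : g, B a b = 0) → a = 0
  B_nondeg_right : ∀ b : g, (∀ a : g, B a b = 0) → b = 0
  B_invariant : ∀ a b c : g, B ⁅a, b⁆ c = B a ⁅b, c⁆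
  Φ : V →ₗ[k] W →ₗ[k] g
  Φ_compat : ∀ (a : g) (v : V) (w : W), B a (Φ v w) = pair (ρ a v) w

/-- The graded Lie algebra `L(g, ρ, V, 𝒱, B₀) = ⊕ₙ Vₙ` associated with a standard pentad,
characterized by its defining properties: it is ℤ-graded, its degrees `0`, `1`, `-1` are the
images of `g`, `V`, `𝒱` (compatibly with the Lie structures and the Φ-map), the higher graded
pieces satisfy `V_{i+1} = [V₁, V_i]`, `V_{-i-1} = [V₋₁, V₋ᵢ]` for `i ≥ 1`, and elements of
`Vₙ`, `|n| ≥ 2`, are by construction (as homomorphisms) determined by their brackets with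
`V_{∓1}`. -/
structure AssocGradedLieAlgebra (k g V W : Type*) [Field k] [LieRing g] [LieAlgebra k g]
    [AddCommGroup V] [Module k V] [AddCommGroup W] [Module k W]
    (P : PentadStruct k g V W) (L : Type*) [LieRing L] [LieAlgebra k L] where
  grading : ℤ → Submodule k L
  isInternal : DirectSum.IsInternal grading
  lie_mem : ∀ (n m : ℤ), ∀ x ∈ grading n, ∀ y ∈ grading m, ⁅x, y⁆ ∈ grading (n + m)
  ιg : g →ₗ[k] L
  ιV : V →ₗ[k] L
  ιW : W →ₗ[k] L
  ιg_inj : Function.Injective ιg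
  ιV_inj : Function.Injective ιV
  ιW_inj : Function.Injective ιW
  ιg_range : LinearMap.range ιg = grading 0
  ιV_range : LinearMap.range ιV = grading 1
  ιW_range : LinearMap.range ιW = grading (-1)
  ιg_lie : ∀ a b : g, ιg ⁅a, b⁆ = ⁅ιg a, ιg b⁆
  lie_ιV : ∀ (a : g) (v : V), ⁅ιg a, ιV v⁆ = ιV (P.ρ a v)
  lie_ιW : ∀ (a : g) (w : W), ⁅ιg a, ιW w⁆ = ιW (P.ϱ a w)
  lie_Φ : ∀ (v : V) (w : W), ⁅ιV v, ιW w⁆ = ιg (P.Φ v w)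
  span_pos : ∀ i : ℤ, 1 ≤ i → grading (i + 1)
    = Submodule.span k {z : L | ∃ x ∈ grading 1, ∃ y ∈ grading i, z = ⁅x, y⁆}
  span_neg : ∀ i : ℤ, 1 ≤ i → grading (-i - 1)
    = Submodule.span k {z : L | ∃ x ∈ grading (-1), ∃ y ∈ grading (-i), z = ⁅x, y⁆}
  trans_pos : ∀ n : ℤ, 2 ≤ n → ∀ x ∈ grading n, (∀ y ∈ grading (-1), ⁅x, y⁆ = 0) → x = 0
  trans_neg : ∀ n : ℤ, 2 ≤ n → ∀ x ∈ grading (-n), (∀ y ∈ grading 1, ⁅x, y⁆ = 0) → x = 0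

/-- Reducibility of a standard pentad: there are an ideal `𝔞 ⊆ g` and `g`-submodules
`V𝔞 ⊆ V`, `W𝔞 ⊆ 𝒱` with `{0} ≠ W𝔞 ⊕ 𝔞 ⊕ V𝔞 ⊊ 𝒱 ⊕ g ⊕ V`, stable under the actions and with
`Φ(V𝔞 ⊗ 𝒱) ⊆ 𝔞` and `Φ(V ⊗ W𝔞) ⊆ 𝔞`. -/
def PentadStruct.IsReducible {k g V W : Type*} [Field k] [LieRing g] [LieAlgebra k g]
    [AddCommGroup V] [Module k V] [AddCommGroup W] [Module k W]
    (P : PentadStruct k g V W) : Prop :=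
  ∃ (𝔞 : Submodule k g) (V𝔞 : Submodule k V) (W𝔞 : Submodule k W),
    (∀ x : g, ∀ a ∈ 𝔞, ⁅x, a⁆ ∈ 𝔞)
    ∧ ¬(W𝔞 = ⊥ ∧ 𝔞 = ⊥ ∧ V𝔞 = ⊥)
    ∧ ¬(W𝔞 = ⊤ ∧ 𝔞 = ⊤ ∧ V𝔞 = ⊤)
    ∧ (∀ a ∈ 𝔞, ∀ v : V, P.ρ a v ∈ V𝔞)
    ∧ (∀ a : g, ∀ v ∈ V𝔞, P.ρ a v ∈ V𝔞)
    ∧ (∀ a ∈ 𝔞, ∀ w : W, P.ϱ a w ∈ W𝔞)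
    ∧ (∀ a : g, ∀ w ∈ W𝔞, P.ϱ a w ∈ W𝔞)
    ∧ (∀ v ∈ V𝔞, ∀ w : W, P.Φ v w ∈ 𝔞)
    ∧ (∀ v : V, ∀ w ∈ W𝔞, P.Φ v w ∈ 𝔞)

section Helpers
variable {k L : Type*} [Field k] [LieRing L] [LieAlgebra k L]

/-- One half of the maximal graded ideal with prescribed local part. -/
def pentadHalf (E : ℕ → Submodule k L) (F N0 N1 : Submodule k L) : ℕ → Submodule k L
  | 0 => N0
  | 1 => N1
  | (n + 2) =>
    { carrier := {x | x ∈ E (n + 2) ∧ ∀ y ∈ F, ⁅x, y⁆ ∈ pentadHalf E F N0 N1 (n + 1)}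
      add_mem' := by
        rintro a b ⟨ha, ha'⟩ ⟨hb, hb'⟩
        refine ⟨add_mem ha hb, fun y hy => ?_⟩
        rw [add_lie]
        exact add_mem (ha' y hy) (hb' y hy)
      zero_mem' := by
        refine ⟨zero_mem _, fun y _ => ?_⟩
        rw [zero_lie]
        exact zero_mem _
      smul_mem' := by
        rintro c a ⟨ha, ha'⟩
        refine ⟨Submodule.smul_mem _ c ha, fun y hy => ?_⟩
        rw [smul_lie]
        exact Submodule.smul_mem _ c (ha' y hy) }

theorem mem_pentadHalf (E : ℕ → Submodule k L) (F N0 N1 : Submodule k L) (n : ℕ) (x : L) :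
    x ∈ pentadHalf E F N0 N1 (n + 2) ↔
      x ∈ E (n + 2) ∧ ∀ y ∈ F, ⁅x, y⁆ ∈ pentadHalf E F N0 N1 (n + 1) := Iff.rfl

theorem pentadHalf_le (E : ℕ → Submodule k L) (F N0 N1 : Submodule k L)
    (h0 : N0 ≤ E 0) (h1 : N1 ≤ E 1) : ∀ n, pentadHalf E F N0 N1 n ≤ E n
  | 0 => h0
  | 1 => h1
  | (_ + 2) => fun _ hx => hx.1

theorem pentadHalf_lie_F (E : ℕ → Submodule k L) (F N0 N1 : Submodule k L)
    (h1F : ∀ x ∈ N1, ∀ y ∈ F, ⁅x, y⁆ ∈ N0) :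
    ∀ n, ∀ x ∈ pentadHalf E F N0 N1 (n + 1), ∀ y ∈ F, ⁅x, y⁆ ∈ pentadHalf E F N0 N1 n
  | 0 => h1F
  | (_ + 1) => fun _ hx => hx.2

theorem pentadHalf_lie_zero (E : ℕ → Submodule k L) (F N0 N1 : Submodule k L)
    (hE0 : ∀ n, ∀ x ∈ E n, ∀ y ∈ E 0, ⁅x, y⁆ ∈ E n)
    (hF0 : ∀ x ∈ F, ∀ y ∈ E 0, ⁅x, y⁆ ∈ F)
    (h00 : ∀ x ∈ N0, ∀ y ∈ E 0, ⁅x, y⁆ ∈ N0)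
    (h10 : ∀ x ∈ N1, ∀ y ∈ E 0, ⁅x, y⁆ ∈ N1) :
    ∀ n, ∀ x ∈ pentadHalf E F N0 N1 n, ∀ y ∈ E 0, ⁅x, y⁆ ∈ pentadHalf E F N0 N1 n := by
  intro n
  induction n using Nat.strong_induction_on with
  | _ n ih =>
    match n, ih with
    | 0, _ => exact h00
    | 1, _ => exact h10
    | n + 2, ih =>
      rintro x ⟨hx, hx'⟩ y hy
      refine ⟨hE0 _ x hx y hy, fun z hz => ?_⟩
      have e : ⁅⁅x, y⁆, z⁆ = ⁅⁅x, z⁆, y⁆ - ⁅x, ⁅z, y⁆⁆ := by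
        rw [lie_lie, ← lie_skew ⁅x, z⁆ y, ← lie_skew z y, lie_neg]; abel
      rw [e]
      exact sub_mem (ih (n + 1) (by omega) _ (hx' z hz) y hy) (hx' _ (hF0 z hz y hy))

theorem pentadHalf_lie_one (E : ℕ → Submodule k L) (F N0 N1 : Submodule k L)
    (hN0 : N0 ≤ E 0) (hN1 : N1 ≤ E 1)
    (hE0 : ∀ n, ∀ x ∈ E n, ∀ y ∈ E 0, ⁅x, y⁆ ∈ E n)
    (hE1 : ∀ n, ∀ x ∈ E n, ∀ y ∈ E 1, ⁅x, y⁆ ∈ E (n + 1))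
    (hF0 : ∀ x ∈ F, ∀ y ∈ E 0, ⁅x, y⁆ ∈ F)
    (hF1 : ∀ x ∈ F, ∀ y ∈ E 1, ⁅x, y⁆ ∈ E 0)
    (h00 : ∀ x ∈ N0, ∀ y ∈ E 0, ⁅x, y⁆ ∈ N0)
    (h10 : ∀ x ∈ N1, ∀ y ∈ E 0, ⁅x, y⁆ ∈ N1)
    (h01 : ∀ x ∈ N0, ∀ y ∈ E 1, ⁅x, y⁆ ∈ N1)
    (h1F : ∀ x ∈ N1, ∀ y ∈ F, ⁅x, y⁆ ∈ N0) :
    ∀ n, ∀ x ∈ pentadHalf E F N0 N1 n, ∀ y ∈ E 1, ⁅x, y⁆ ∈ pentadHalf E F N0 N1 (n + 1) := by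
  intro n
  induction n with
  | zero => exact h01
  | succ n ih =>
    intro x hx y hy
    refine ⟨hE1 _ x (pentadHalf_le E F N0 N1 hN0 hN1 _ hx) y hy, fun z hz => ?_⟩
    have e : ⁅⁅x, y⁆, z⁆ = ⁅⁅x, z⁆, y⁆ - ⁅x, ⁅z, y⁆⁆ := by
      rw [lie_lie, ← lie_skew ⁅x, z⁆ y, ← lie_skew z y, lie_neg]; abel
    rw [e]
    exact sub_mem (ih _ (pentadHalf_lie_F E F N0 N1 h1F n x hx z hz) y hy)
      (pentadHalf_lie_zero E F N0 N1 hE0 hF0 h00 h10 _ x hx _ (hF1 z hz y hy))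

theorem pentad_mem_of_indep (G J : ℤ → Submodule k L) (hG : iSupIndep G) (hJ : ∀ n, J n ≤ G n)
    (m : ℤ) (x : L) (hx : x ∈ ⨆ n, J n) (hxm : x ∈ G m) : x ∈ J m := by
  have h : (⨆ n, J n) ≤ J m ⊔ ⨆ n, ⨆ _ : n ≠ m, J n := by
    refine iSup_le fun n => ?_
    by_cases hn : n = m
    · subst hn; exact le_sup_left
    · exact le_sup_of_le_right (le_iSup₂_of_le n hn le_rfl)
  obtain ⟨a, ha, b, hb, hab⟩ := Submodule.mem_sup.1 (h hx)
  have hb1 : b ∈ G m := by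
    have : b = x - a := by rw [← hab]; abel
    rw [this]
    exact sub_mem hxm (hJ m ha)
  have hb2 : b ∈ ⨆ n, ⨆ _ : n ≠ m, G n := (iSup₂_mono fun n _ => hJ n) hb
  have : b = 0 := Submodule.disjoint_def.1 (hG m) b hb1 hb2
  rw [← hab, this, add_zero]
  exact ha

variable {g V W : Type*} [LieRing g] [LieAlgebra k g]
    [AddCommGroup V] [Module k V] [AddCommGroup W] [Module k W]
    {P : PentadStruct k g V W}

/-- A submodule closed under brackets and containing the local part is everything. -/
theorem pentad_generated (A : AssocGradedLieAlgebra k g V W P L) (N : Submodule k L)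
    (hlie : ∀ a ∈ N, ∀ b ∈ N, ⁅a, b⁆ ∈ N)
    (n0 : A.grading 0 ≤ N) (n1 : A.grading 1 ≤ N) (n2 : A.grading (-1) ≤ N) (y : L) : y ∈ N := by
  have hp : ∀ n : ℕ, A.grading ((n : ℤ) + 1) ≤ N := by
    intro n
    induction n with
    | zero => simpa using n1
    | succ n ih =>
      push_cast
      rw [A.span_pos _ (by omega), Submodule.span_le]
      rintro _ ⟨a, ha, b, hb, rfl⟩
      exact hlie a (n1 ha) b (ih hb)
  have hn : ∀ n : ℕ, A.grading (-((n : ℤ) + 1)) ≤ N := by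
    intro n
    induction n with
    | zero => simpa using n2
    | succ n ih =>
      have e : (-(((n + 1 : ℕ) : ℤ) + 1)) = -((n : ℤ) + 1) - 1 := by push_cast; ring
      rw [e, A.span_neg _ (by omega), Submodule.span_le]
      rintro _ ⟨a, ha, b, hb, rfl⟩
      exact hlie a (n2 ha) b (ih hb)
  have hall : (⨆ n, A.grading n) ≤ N := by
    refine iSup_le fun n => ?_
    rcases lt_trichotomy n 0 with h | h | h
    · obtain ⟨m, hm⟩ := Int.eq_ofNat_of_zero_le (a := -n - 1) (by omega)
      have : n = -((m : ℤ) + 1) := by omega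
      rw [this]; exact hn m
    · rw [h]; exact n0
    · obtain ⟨m, hm⟩ := Int.eq_ofNat_of_zero_le (a := n - 1) (by omega)
      have : n = (m : ℤ) + 1 := by omega
      rw [this]; exact hp m
  apply hall
  rw [A.isInternal.submodule_iSup_eq_top]
  exact Submodule.mem_top

/-- A submodule stable under the local part is stable under everything. -/
theorem pentad_stable (A : AssocGradedLieAlgebra k g V W P L) (J : Submodule k L)
    (h0 : ∀ x ∈ J, ∀ y ∈ A.grading 0, ⁅y, x⁆ ∈ J)
    (h1 : ∀ x ∈ J, ∀ y ∈ A.grading 1, ⁅y, x⁆ ∈ J)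
    (h2 : ∀ x ∈ J, ∀ y ∈ A.grading (-1), ⁅y, x⁆ ∈ J) (y x : L) (hx : x ∈ J) : ⁅y, x⁆ ∈ J := by
  let N : Submodule k L :=
    { carrier := {y | ∀ x ∈ J, ⁅y, x⁆ ∈ J}
      add_mem' := fun {a b} ha hb x hx => by
        rw [add_lie]; exact add_mem (ha x hx) (hb x hx)
      zero_mem' := fun x _ => by rw [zero_lie]; exact zero_mem _
      smul_mem' := fun c a ha x hx => by
        rw [smul_lie]; exact Submodule.smul_mem _ c (ha x hx) }
  have hlie : ∀ a ∈ N, ∀ b ∈ N, ⁅a, b⁆ ∈ N := by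
    intro a ha b hb x hx
    rw [lie_lie]
    exact sub_mem (ha _ (hb x hx)) (hb _ (ha x hx))
  have n0 : A.grading 0 ≤ N := fun y hy x hx => h0 x hx y hy
  have n1 : A.grading 1 ≤ N := fun y hy x hx => h1 x hx y hy
  have n2 : A.grading (-1) ≤ N := fun y hy x hx => h2 x hx y hy
  exact (pentad_generated A N hlie n0 n1 n2 : ∀ y, y ∈ N) y x hx

/-- The ideal attached to a local triple. -/
theorem pentad_exists_ideal (A : AssocGradedLieAlgebra k g V W P L) (N0 N1 M1 : Submodule k L)
    (hN0 : N0 ≤ A.grading 0) (hN1 : N1 ≤ A.grading 1) (hM1 : M1 ≤ A.grading (-1))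
    (h00 : ∀ x ∈ N0, ∀ y ∈ A.grading 0, ⁅x, y⁆ ∈ N0)
    (h10 : ∀ x ∈ N1, ∀ y ∈ A.grading 0, ⁅x, y⁆ ∈ N1)
    (m10 : ∀ x ∈ M1, ∀ y ∈ A.grading 0, ⁅x, y⁆ ∈ M1)
    (h01 : ∀ x ∈ N0, ∀ y ∈ A.grading 1, ⁅x, y⁆ ∈ N1)
    (m01 : ∀ x ∈ N0, ∀ y ∈ A.grading (-1), ⁅x, y⁆ ∈ M1)
    (h1F : ∀ x ∈ N1, ∀ y ∈ A.grading (-1), ⁅x, y⁆ ∈ N0)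
    (m1F : ∀ x ∈ M1, ∀ y ∈ A.grading 1, ⁅x, y⁆ ∈ N0) :
    ∃ I : LieIdeal k L, (I : Submodule k L) = ⨆ n : ℤ, ((I : Submodule k L) ⊓ A.grading n)
      ∧ (I : Submodule k L) ⊓ A.grading 0 = N0 ∧ (I : Submodule k L) ⊓ A.grading 1 = N1
      ∧ (I : Submodule k L) ⊓ A.grading (-1) = M1 := by
  have gl : ∀ (n m p : ℤ), n + m = p → ∀ x ∈ A.grading n, ∀ y ∈ A.grading m,
      ⁅x, y⁆ ∈ A.grading p := by
    rintro n m p rfl; exact A.lie_mem n m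
  let E : ℕ → Submodule k L := fun n => A.grading (n : ℤ)
  let E' : ℕ → Submodule k L := fun n => A.grading (-(n : ℤ))
  let H := pentadHalf E (A.grading (-1)) N0 N1
  let H' := pentadHalf E' (A.grading 1) N0 M1
  have e0 : E 0 = A.grading 0 := by simp [E]
  have e0' : E' 0 = A.grading 0 := by simp [E']
  have e1 : E 1 = A.grading 1 := by simp [E]
  have e1' : E' 1 = A.grading (-1) := by simp [E']
  have hHle : ∀ n, H n ≤ E n := pentadHalf_le _ _ _ _ (by rwa [e0]) (by rwa [e1])
  have hHle' : ∀ n, H' n ≤ E' n := pentadHalf_le _ _ _ _ (by rwa [e0']) (by rwa [e1'])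
  have Hz : ∀ n, ∀ x ∈ H n, ∀ y ∈ A.grading 0, ⁅x, y⁆ ∈ H n := by
    have := pentadHalf_lie_zero E (A.grading (-1)) N0 N1
    rw [e0] at this
    exact this (fun n => gl _ _ _ (by simp)) (gl _ _ _ (by simp)) h00 h10
  have Hz' : ∀ n, ∀ x ∈ H' n, ∀ y ∈ A.grading 0, ⁅x, y⁆ ∈ H' n := by
    have := pentadHalf_lie_zero E' (A.grading 1) N0 M1
    rw [e0'] at this
    exact this (fun n => gl _ _ _ (by simp)) (gl _ _ _ (by simp)) h00 m10
  have Hp : ∀ n, ∀ x ∈ H n, ∀ y ∈ A.grading 1, ⁅x, y⁆ ∈ H (n + 1) := by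
    have := pentadHalf_lie_one E (A.grading (-1)) N0 N1
    rw [e0, e1] at this
    exact this hN0 hN1 (fun n => gl _ _ _ (by simp)) (fun n => gl _ _ _ (by simp))
      (gl _ _ _ (by simp)) (gl _ _ _ (by simp)) h00 h10 h01 h1F
  have Hp' : ∀ n, ∀ x ∈ H' n, ∀ y ∈ A.grading (-1), ⁅x, y⁆ ∈ H' (n + 1) := by
    have := pentadHalf_lie_one E' (A.grading 1) N0 M1
    rw [e0', e1'] at this
    exact this hN0 hM1 (fun n => gl _ _ _ (by simp))
      (fun n => gl _ _ _ (by push_cast; ring))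
      (gl _ _ _ (by simp)) (gl _ _ _ (by simp)) h00 m10 m01 m1F
  have Hm : ∀ n, ∀ x ∈ H (n + 1), ∀ y ∈ A.grading (-1), ⁅x, y⁆ ∈ H n :=
    pentadHalf_lie_F E (A.grading (-1)) N0 N1 h1F
  have Hm' : ∀ n, ∀ x ∈ H' (n + 1), ∀ y ∈ A.grading 1, ⁅x, y⁆ ∈ H' n :=
    pentadHalf_lie_F E' (A.grading 1) N0 M1 m1F
  let J : ℤ → Submodule k L := fun z => match z with
    | Int.ofNat n => H n
    | Int.negSucc n => H' (n + 1)
  have hJle : ∀ z, J z ≤ A.grading z := by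
    intro z
    match z with
    | Int.ofNat n => exact hHle n
    | Int.negSucc n => exact hHle' (n + 1)
  have JH : ∀ n, H n ≤ ⨆ z, J z := fun n => le_iSup J (Int.ofNat n)
  have JH' : ∀ n, H' n ≤ ⨆ z, J z := fun n => by
    match n with
    | 0 => exact JH 0
    | n + 1 => exact le_iSup J (Int.negSucc n)
  have key : ∀ y : L, (∀ n, ∀ x ∈ H n, ⁅x, y⁆ ∈ ⨆ z, J z) →
      (∀ n, ∀ x ∈ H' (n + 1), ⁅x, y⁆ ∈ ⨆ z, J z) → ∀ x ∈ ⨆ z, J z, ⁅y, x⁆ ∈ ⨆ z, J z := by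
    intro y hy hy' x hx
    have : (⨆ z, J z) ≤ (⨆ z, J z).comap (LieAlgebra.ad k L y : L →ₗ[k] L) := by
      refine iSup_le fun z x hx => ?_
      rw [Submodule.mem_comap, LieAlgebra.ad_apply, ← lie_skew]
      apply neg_mem
      match z, hx with
      | Int.ofNat n, hx => exact hy n x hx
      | Int.negSucc n, hx => exact hy' n x hx
    exact this hx
  let I : LieIdeal k L :=
    { (⨆ z, J z : Submodule k L) with
      lie_mem := by
        intro y x hx
        refine pentad_stable A (⨆ z, J z) ?_ ?_ ?_ y x hx
        · intro x hx y hy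
          exact key y (fun n x hx => JH _ (Hz n x hx y hy))
            (fun n x hx => JH' _ (Hz' _ x hx y hy)) x hx
        · intro x hx y hy
          exact key y (fun n x hx => JH _ (Hp n x hx y hy))
            (fun n x hx => JH' _ (Hm' _ x hx y hy)) x hx
        · intro x hx y hy
          refine key y (fun n x hx => ?_) (fun n x hx => JH' _ (Hp' _ x hx y hy)) x hx
          match n, hx with
          | 0, hx => exact JH' 1 (Hp' 0 x hx y hy)
          | n + 1, hx => exact JH _ (Hm _ x hx y hy) }
  have hI : (I : Submodule k L) = ⨆ z, J z := rfl
  have hcap : ∀ z, (I : Submodule k L) ⊓ A.grading z = J z := by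
    intro z
    apply le_antisymm
    · rintro x ⟨hx, hx'⟩
      exact pentad_mem_of_indep A.grading J A.isInternal.submodule_iSupIndep hJle z x hx hx'
    · exact le_inf (le_iSup J z) (hJle z)
  refine ⟨I, ?_, hcap 0, hcap 1, hcap (-1)⟩
  simp_rw [hcap]
  exact hI

end Helpers

/-- Let `(g, ρ, V, 𝒱, B₀)` be a standard pentad with `ρ` faithful.  Then the
pentad is irreducible if and only if the associated graded Lie algebra `L(g,ρ,V,𝒱,B₀)` has no
nonzero proper graded ideal. -/
theorem statement12
    {k g V W L : Type*} [Field k] [LieRing g] [LieAlgebra k g]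
    [AddCommGroup V] [Module k V] [AddCommGroup W] [Module k W]
    [LieRing L] [LieAlgebra k L]
    (P : PentadStruct k g V W)
    (A : AssocGradedLieAlgebra k g V W P L)
    (hρ_faithful : ∀ a : g, P.ρ a = 0 → a = 0) :
    ¬ P.IsReducible ↔
      ∀ I : LieIdeal k L,
        (I : Submodule k L) = ⨆ n : ℤ, ((I : Submodule k L) ⊓ A.grading n) →
        I = ⊥ ∨ I = ⊤ := by
  have mg : ∀ a, A.ιg a ∈ A.grading 0 := fun a => A.ιg_range ▸ LinearMap.mem_range_self _ a
  have mV : ∀ a, A.ιV a ∈ A.grading 1 := fun a => A.ιV_range ▸ LinearMap.mem_range_self _ a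
  have mW : ∀ a, A.ιW a ∈ A.grading (-1) := fun a => A.ιW_range ▸ LinearMap.mem_range_self _ a
  have eg : ∀ x ∈ A.grading 0, ∃ a, A.ιg a = x := fun x hx => by
    rw [← A.ιg_range] at hx; exact hx
  have eV : ∀ x ∈ A.grading 1, ∃ a, A.ιV a = x := fun x hx => by
    rw [← A.ιV_range] at hx; exact hx
  have eW : ∀ x ∈ A.grading (-1), ∃ a, A.ιW a = x := fun x hx => by
    rw [← A.ιW_range] at hx; exact hx
  constructor
  · intro hirr I hI
    have hlr : ∀ x y : L, y ∈ I → ⁅x, y⁆ ∈ I := fun x y hy => lie_mem_right k L I x y hy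
    have hll : ∀ x y : L, x ∈ I → ⁅x, y⁆ ∈ I := fun x y hy => lie_mem_left k L I x y hy
    let Is : Submodule k L := (I : Submodule k L)
    have hIs : ∀ x, x ∈ Is ↔ x ∈ I := fun x => Iff.rfl
    by_contra hcon
    push Not at hcon
    apply hirr
    refine ⟨Is.comap A.ιg, Is.comap A.ιV, Is.comap A.ιW, ?_, ?_, ?_, ?_, ?_, ?_, ?_, ?_, ?_⟩
    · intro x a ha
      rw [Submodule.mem_comap, A.ιg_lie]; exact hlr _ _ ha
    · rintro ⟨hW, hg, hV⟩
      apply hcon.1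
      have c0 : ∀ x ∈ I, x ∈ A.grading 0 → x = 0 := by
        intro x hx hx'
        obtain ⟨a, rfl⟩ := eg x hx'
        have : a ∈ Is.comap A.ιg := hx
        rw [hg, Submodule.mem_bot] at this
        rw [this, map_zero]
      have c1 : ∀ x ∈ I, x ∈ A.grading 1 → x = 0 := by
        intro x hx hx'
        obtain ⟨a, rfl⟩ := eV x hx'
        have : a ∈ Is.comap A.ιV := hx
        rw [hV, Submodule.mem_bot] at this
        rw [this, map_zero]
      have c2 : ∀ x ∈ I, x ∈ A.grading (-1) → x = 0 := by
        intro x hx hx'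
        obtain ⟨a, rfl⟩ := eW x hx'
        have : a ∈ Is.comap A.ιW := hx
        rw [hW, Submodule.mem_bot] at this
        rw [this, map_zero]
      have cp : ∀ n : ℕ, ∀ x ∈ I, x ∈ A.grading ((n : ℤ) + 1) → x = 0 := by
        intro n
        induction n with
        | zero => simpa using c1
        | succ n ih =>
          intro x hx hx'
          refine A.trans_pos _ (by push_cast; omega) x hx' fun y hy => ?_
          apply ih _ (hll _ _ hx)
          have := A.lie_mem _ _ x hx' y hy
          push_cast at this
          simpa using this
      have cn : ∀ n : ℕ, ∀ x ∈ I, x ∈ A.grading (-((n : ℤ) + 1)) → x = 0 := by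
        intro n
        induction n with
        | zero => simpa using c2
        | succ n ih =>
          intro x hx hx'
          refine A.trans_neg _ (by push_cast; omega) x hx' fun y hy => ?_
          apply ih _ (hll _ _ hx)
          have := A.lie_mem _ _ x hx' y hy
          have e : (-(((n + 1 : ℕ) : ℤ) + 1)) + 1 = -((n : ℤ) + 1) := by push_cast; ring
          rwa [e] at this
      have hz : (⨆ n : ℤ, ((I : Submodule k L) ⊓ A.grading n)) ≤ ⊥ := by
        refine iSup_le fun n => ?_
        rintro x ⟨hx, hx'⟩
        rw [Submodule.mem_bot]
        rcases lt_trichotomy n 0 with h | h | h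
        · obtain ⟨m, hm⟩ := Int.eq_ofNat_of_zero_le (a := -n - 1) (by omega)
          have : n = -((m : ℤ) + 1) := by omega
          exact cn m x hx (this ▸ hx')
        · exact c0 x hx (h ▸ hx')
        · obtain ⟨m, hm⟩ := Int.eq_ofNat_of_zero_le (a := n - 1) (by omega)
          have : n = (m : ℤ) + 1 := by omega
          exact cp m x hx (this ▸ hx')
      rw [← hI] at hz
      rw [eq_bot_iff]
      intro x hx
      exact hz hx
    · rintro ⟨hW, hg, hV⟩
      apply hcon.2
      rw [eq_top_iff]
      intro x _
      refine pentad_generated A Is (fun a _ b hb => hlr a b hb) ?_ ?_ ?_ x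
      · intro x hx
        obtain ⟨a, rfl⟩ := eg x hx
        have : a ∈ Is.comap A.ιg := by rw [hg]; trivial
        exact this
      · intro x hx
        obtain ⟨a, rfl⟩ := eV x hx
        have : a ∈ Is.comap A.ιV := by rw [hV]; trivial
        exact this
      · intro x hx
        obtain ⟨a, rfl⟩ := eW x hx
        have : a ∈ Is.comap A.ιW := by rw [hW]; trivial
        exact this
    · intro a ha v
      rw [Submodule.mem_comap, ← A.lie_ιV]; exact hll _ _ ha
    · intro a v hv
      rw [Submodule.mem_comap, ← A.lie_ιV]; exact hlr _ _ hv
    · intro a ha v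
      rw [Submodule.mem_comap, ← A.lie_ιW]; exact hll _ _ ha
    · intro a v hv
      rw [Submodule.mem_comap, ← A.lie_ιW]; exact hlr _ _ hv
    · intro v hv w
      rw [Submodule.mem_comap, ← A.lie_Φ]; exact hll _ _ hv
    · intro v w hw
      rw [Submodule.mem_comap, ← A.lie_Φ]; exact hlr _ _ hw
  · rintro h ⟨a, Va, Wa, haa, hne, hnt, hav, hgv, haw, hgw, hvw, hvw'⟩
    obtain ⟨I, hI, i0, i1, i2⟩ := pentad_exists_ideal A (a.map A.ιg) (Va.map A.ιV) (Wa.map A.ιW)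
      (by rintro _ ⟨x, _, rfl⟩; exact mg x) (by rintro _ ⟨x, _, rfl⟩; exact mV x)
      (by rintro _ ⟨x, _, rfl⟩; exact mW x)
      (by
        rintro _ ⟨x, hx, rfl⟩ y hy
        obtain ⟨y, rfl⟩ := eg y hy
        rw [← lie_skew, ← A.ιg_lie]
        exact neg_mem (Submodule.mem_map_of_mem (haa y x hx)))
      (by
        rintro _ ⟨x, hx, rfl⟩ y hy
        obtain ⟨y, rfl⟩ := eg y hy
        rw [← lie_skew, A.lie_ιV]
        exact neg_mem (Submodule.mem_map_of_mem (hgv y x hx)))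
      (by
        rintro _ ⟨x, hx, rfl⟩ y hy
        obtain ⟨y, rfl⟩ := eg y hy
        rw [← lie_skew, A.lie_ιW]
        exact neg_mem (Submodule.mem_map_of_mem (hgw y x hx)))
      (by
        rintro _ ⟨x, hx, rfl⟩ y hy
        obtain ⟨y, rfl⟩ := eV y hy
        rw [A.lie_ιV]
        exact Submodule.mem_map_of_mem (hav x hx y))
      (by
        rintro _ ⟨x, hx, rfl⟩ y hy
        obtain ⟨y, rfl⟩ := eW y hy
        rw [A.lie_ιW]
        exact Submodule.mem_map_of_mem (haw x hx y))
      (by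
        rintro _ ⟨x, hx, rfl⟩ y hy
        obtain ⟨y, rfl⟩ := eW y hy
        rw [A.lie_Φ]
        exact Submodule.mem_map_of_mem (hvw x hx y))
      (by
        rintro _ ⟨x, hx, rfl⟩ y hy
        obtain ⟨y, rfl⟩ := eV y hy
        rw [← lie_skew, A.lie_Φ]
        exact neg_mem (Submodule.mem_map_of_mem (hvw' y x hx)))
    rcases h I hI with rfl | rfl
    · apply hne
      have hb : (((⊥ : LieIdeal k L) : LieSubalgebra k L) : Submodule k L) = ⊥ := rfl
      rw [hb, bot_inf_eq] at i0 i1 i2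
      exact ⟨Submodule.map_injective_of_injective A.ιW_inj (by rw [← i2, Submodule.map_bot]),
        Submodule.map_injective_of_injective A.ιg_inj (by rw [← i0, Submodule.map_bot]),
        Submodule.map_injective_of_injective A.ιV_inj (by rw [← i1, Submodule.map_bot])⟩
    · apply hnt
      have hb : (((⊤ : LieIdeal k L) : LieSubalgebra k L) : Submodule k L) = ⊤ := rfl
      rw [hb, top_inf_eq] at i0 i1 i2
      refine ⟨eq_top_iff.2 fun x _ => ?_, eq_top_iff.2 fun x _ => ?_, eq_top_iff.2 fun x _ => ?_⟩
      · have := mW x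
        rw [i2] at this
        obtain ⟨y, hy, e⟩ := this
        rwa [← A.ιW_inj e]
      · have := mg x
        rw [i0] at this
        obtain ⟨y, hy, e⟩ := this
        rwa [← A.ιg_inj e]
      · have := mV x
        rw [i1] at this
        obtain ⟨y, hy, e⟩ := this
        rwa [← A.ιV_inj e]
end

section
/- Let (g,ρ,V,𝒱,B₀) be a standard pentad, L its associated graded Lie algebra, and let (π̲, U̲) = (π̲, ⊕_{m≥0} U̲_m) be a positively graded L-module that is transitive and generated by V₀, V₁ and U̲₀. Then U̲ is isomorphic as an L-module to the positive extension of the g-module U̲₀ with respect to (g,ρ,V,𝒱,B₀). -/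
/-- The **positive extension** `Ũ⁺ = ⊕_{m≥0} U⁺ₘ` of the `g`-module `U⁺₀` with respect to a
standard pentad, as an `L`-module: it is positively graded, transitive, and generated by
`V₀`, `V₁` and `U⁺₀` (i.e. `U⁺_{m+1} = V₁ · U⁺ₘ`). -/
structure PositiveExtension (k g V W : Type*) [Field k] [LieRing g] [LieAlgebra k g]
    [AddCommGroup V] [Module k V] [AddCommGroup W] [Module k W]
    (P : PentadStruct k g V W) (L : Type*) [LieRing L] [LieAlgebra k L]
    (A : AssocGradedLieAlgebra k g V W P L)
    (M : Type*) [AddCommGroup M] [Module k M] [LieRingModule L M] [LieModule k L M] where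
  grading : ℤ → Submodule k M
  isInternal : DirectSum.IsInternal grading
  zero_of_neg : ∀ n : ℤ, n < 0 → grading n = ⊥
  lie_mem : ∀ (n m : ℤ), ∀ x ∈ A.grading n, ∀ u ∈ grading m, ⁅x, u⁆ ∈ grading (n + m)
  transitive : ∀ m : ℤ, 1 ≤ m → ∀ u ∈ grading m,
    (∀ y ∈ A.grading (-1), ⁅y, u⁆ = 0) → u = 0
  span_step : ∀ m : ℤ, 0 ≤ m → grading (m + 1)
    = Submodule.span k {w : M | ∃ x ∈ A.grading 1, ∃ u ∈ grading m, w = ⁅x, u⁆}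

namespace PosExtAux

section ProdModule

variable {k L M M₂ : Type*} [Field k] [LieRing L] [LieAlgebra k L]
    [AddCommGroup M] [Module k M] [LieRingModule L M] [LieModule k L M]
    [AddCommGroup M₂] [Module k M₂] [LieRingModule L M₂] [LieModule k L M₂]

/-- The product of two Lie modules, with the diagonal action. -/
instance prodLieRingModule : LieRingModule L (M × M₂) where
  bracket x z := (⁅x, z.1⁆, ⁅x, z.2⁆)
  add_lie x y z := by ext <;> exact add_lie _ _ _
  lie_add x y z := by ext <;> exact lie_add _ _ _
  leibniz_lie x y z := by ext <;> exact leibniz_lie _ _ _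

theorem prod_lie (x : L) (z : M × M₂) : ⁅x, z⁆ = (⁅x, z.1⁆, ⁅x, z.2⁆) := rfl

instance prodLieModule : LieModule k L (M × M₂) where
  smul_lie t x z := by ext <;> exact smul_lie _ _ _
  lie_smul t x z := by ext <;> exact lie_smul _ _ _

end ProdModule

section Graph

variable {k g V W L M N : Type*} [Field k] [LieRing g] [LieAlgebra k g]
    [AddCommGroup V] [Module k V] [AddCommGroup W] [Module k W]
    [LieRing L] [LieAlgebra k L]
    [AddCommGroup M] [Module k M] [LieRingModule L M] [LieModule k L M]
    [AddCommGroup N] [Module k N] [LieRingModule L N] [LieModule k L N]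
    {P : PentadStruct k g V W}

/-- The subspaces generated from `G` by repeated action of the degree one part. -/
def gr (A : AssocGradedLieAlgebra k g V W P L) (G : Submodule k N) : ℕ → Submodule k N
  | 0 => G
  | m + 1 => Submodule.span k {z : N | ∃ x ∈ A.grading 1, ∃ u ∈ gr A G m, z = ⁅x, u⁆}

variable (A : AssocGradedLieAlgebra k g V W P L) (G : Submodule k N)

theorem gr_one (m : ℕ) (x : L) (hx : x ∈ A.grading 1) (u : N) (hu : u ∈ gr A G m) :
    ⁅x, u⁆ ∈ gr A G (m + 1) :=
  Submodule.subset_span ⟨x, hx, u, hu, rfl⟩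

theorem gr_zero (h0 : ∀ x ∈ A.grading 0, ∀ z ∈ G, ⁅x, z⁆ ∈ G) (m : ℕ) :
    ∀ x ∈ A.grading 0, ∀ z ∈ gr A G m, ⁅x, z⁆ ∈ gr A G m := by
  induction m with
  | zero => exact h0
  | succ m ih =>
    intro x hx z hz
    have hle : gr A G (m + 1) ≤ (gr A G (m + 1)).comap (LieModule.toEnd k L N x) := by
      conv_lhs => rw [gr]
      rw [Submodule.span_le]
      rintro _ ⟨y, hy, u, hu, rfl⟩
      change ⁅x, ⁅y, u⁆⁆ ∈ gr A G (m + 1)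
      rw [leibniz_lie]
      refine add_mem (gr_one A G m _ ?_ _ hu) (gr_one A G m _ hy _ (ih x hx u hu))
      simpa using A.lie_mem 0 1 x hx y hy
    exact hle hz

theorem gr_neg (h0 : ∀ x ∈ A.grading 0, ∀ z ∈ G, ⁅x, z⁆ ∈ G)
    (h1 : ∀ x ∈ A.grading (-1), ∀ z ∈ G, ⁅x, z⁆ = 0) (m : ℕ) :
    ∀ x ∈ A.grading (-1), ∀ z ∈ gr A G (m + 1), ⁅x, z⁆ ∈ gr A G m := by
  have key : ∀ m : ℕ, (∀ x ∈ A.grading (-1), ∀ y ∈ A.grading 1, ∀ u ∈ gr A G m,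
      ⁅y, ⁅x, u⁆⁆ ∈ gr A G m) →
      ∀ x ∈ A.grading (-1), ∀ z ∈ gr A G (m + 1), ⁅x, z⁆ ∈ gr A G m := by
    intro m h x hx z hz
    have hle : gr A G (m + 1) ≤ (gr A G m).comap (LieModule.toEnd k L N x) := by
      rw [gr, Submodule.span_le]
      rintro _ ⟨y, hy, u, hu, rfl⟩
      change ⁅x, ⁅y, u⁆⁆ ∈ gr A G m
      rw [leibniz_lie]
      refine add_mem (gr_zero A G h0 m _ ?_ _ hu) (h x hx y hy u hu)
      simpa using A.lie_mem (-1) 1 x hx y hy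
    exact hle hz
  induction m with
  | zero =>
    apply key
    intro x hx y hy u hu
    rw [h1 x hx u hu, lie_zero]
    exact zero_mem _
  | succ m ih =>
    apply key
    intro x hx y hy u hu
    exact gr_one A G m y hy _ (ih x hx u hu)

/-- The stabilizer of a subspace, as a subspace of the Lie algebra. -/
def stab (L : Type*) [LieRing L] [LieAlgebra k L] [LieRingModule L N] [LieModule k L N]
    (S : Submodule k N) : Submodule k L where
  carrier := {x | ∀ z ∈ S, ⁅x, z⁆ ∈ S}
  add_mem' := by
    intro a b ha hb z hz
    rw [add_lie]
    exact add_mem (ha z hz) (hb z hz)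
  zero_mem' := by
    intro z _
    rw [zero_lie]
    exact zero_mem _
  smul_mem' := by
    intro c x hx z hz
    rw [smul_lie]
    exact S.smul_mem c (hx z hz)

theorem stab_lie (S : Submodule k N) (x y : L) (hx : x ∈ stab L S) (hy : y ∈ stab L S) :
    ⁅x, y⁆ ∈ stab L S := by
  intro z hz
  rw [lie_lie]
  exact sub_mem (hx _ (hy _ hz)) (hy _ (hx _ hz))

theorem stab_top (S : Submodule k N) (h0 : A.grading 0 ≤ stab L S)
    (h1 : A.grading 1 ≤ stab L S) (hn : A.grading (-1) ≤ stab L S) : stab L S = ⊤ := by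
  have hp : ∀ n : ℕ, A.grading ((n : ℤ) + 1) ≤ stab L S := by
    intro n
    induction n with
    | zero => simpa using h1
    | succ n ih =>
      push_cast
      rw [A.span_pos _ (by lia), Submodule.span_le]
      rintro _ ⟨x, hx, y, hy, rfl⟩
      exact stab_lie S x y (h1 hx) (ih hy)
  have hm : ∀ n : ℕ, A.grading (-((n : ℤ) + 1)) ≤ stab L S := by
    intro n
    induction n with
    | zero => simpa using hn
    | succ n ih =>
      have : (-(((n + 1 : ℕ) : ℤ) + 1)) = -((n : ℤ) + 1) - 1 := by push_cast; ring
      rw [this, A.span_neg _ (by lia), Submodule.span_le]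
      rintro _ ⟨x, hx, y, hy, rfl⟩
      exact stab_lie S x y (hn hx) (ih hy)
  rw [eq_top_iff, ← A.isInternal.submodule_iSup_eq_top, iSup_le_iff]
  intro i
  rcases lt_trichotomy i 0 with h | h | h
  · have := hm (-i - 1).toNat
    rwa [show (-(((-i - 1).toNat : ℤ) + 1)) = i by lia] at this
  · rwa [h]
  · have := hp (i - 1).toNat
    rwa [show (((i - 1).toNat : ℤ) + 1) = i by lia] at this

theorem iSup_stable (h0 : ∀ x ∈ A.grading 0, ∀ z ∈ G, ⁅x, z⁆ ∈ G)
    (h1 : ∀ x ∈ A.grading (-1), ∀ z ∈ G, ⁅x, z⁆ = 0) (x : L) (z : N)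
    (hz : z ∈ ⨆ m, gr A G m) : ⁅x, z⁆ ∈ ⨆ m, gr A G m := by
  have key : ∀ x : L, (∀ m, ∀ u ∈ gr A G m, ⁅x, u⁆ ∈ ⨆ m, gr A G m) →
      x ∈ stab L (⨆ m, gr A G m) := by
    intro x h z hz
    have hle : (⨆ m, gr A G m) ≤ (⨆ m, gr A G m).comap (LieModule.toEnd k L N x) :=
      iSup_le fun m u hu => h m u hu
    exact hle hz
  have ht := stab_top A (⨆ m, gr A G m)
    (fun x hx => key x fun m u hu => Submodule.mem_iSup_of_mem m (gr_zero A G h0 m x hx u hu))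
    (fun x hx => key x fun m u hu => Submodule.mem_iSup_of_mem (m + 1) (gr_one A G m x hx u hu))
    (fun x hx => key x fun m u hu => by
      cases m with
      | zero => rw [h1 x hx u hu]; exact zero_mem _
      | succ m => exact Submodule.mem_iSup_of_mem m (gr_neg A G h0 h1 m x hx u hu))
  have hx : x ∈ stab L (⨆ m, gr A G m) := by rw [ht]; trivial
  exact hx z hz

variable {A}

theorem map_gr (E : PositiveExtension k g V W P L A M) (p : N →ₗ[k] M)
    (hp : ∀ (x : L) (z : N), p ⁅x, z⁆ = ⁅x, p z⁆) (hG : G.map p = E.grading 0) (m : ℕ) :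
    (gr A G m).map p = E.grading m := by
  induction m with
  | zero => simpa [gr] using hG
  | succ m ih =>
    push_cast
    rw [gr, E.span_step _ (by lia), Submodule.map_span]
    congr 1
    ext w
    constructor
    · rintro ⟨_, ⟨x, hx, u, hu, rfl⟩, rfl⟩
      exact ⟨x, hx, p u, ih ▸ Submodule.mem_map_of_mem hu, hp x u⟩
    · rintro ⟨x, hx, u, hu, rfl⟩
      rw [← ih] at hu
      obtain ⟨u, hu, rfl⟩ := hu
      exact ⟨_, ⟨x, hx, u, hu, rfl⟩, hp x u⟩

theorem surj_gr (E : PositiveExtension k g V W P L A M) (p : N →ₗ[k] M)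
    (hp : ∀ (x : L) (z : N), p ⁅x, z⁆ = ⁅x, p z⁆) (hG : G.map p = E.grading 0) :
    (⨆ m, gr A G m).map p = ⊤ := by
  rw [Submodule.map_iSup, eq_top_iff, ← E.isInternal.submodule_iSup_eq_top, iSup_le_iff]
  intro i
  rcases lt_or_ge i 0 with h | h
  · rw [E.zero_of_neg i h]; exact bot_le
  · obtain ⟨n, rfl⟩ := Int.eq_ofNat_of_zero_le h
    exact le_trans (map_gr G E p hp hG n).ge (le_iSup (fun m => (gr A G m).map p) n)

theorem inj_gr_hom (p : N →ₗ[k] M)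
    (hp : ∀ (x : L) (z : N), p ⁅x, z⁆ = ⁅x, p z⁆)
    (hinj : ∀ z ∈ G, p z = 0 → z = 0)
    (h0 : ∀ x ∈ A.grading 0, ∀ z ∈ G, ⁅x, z⁆ ∈ G)
    (h1 : ∀ x ∈ A.grading (-1), ∀ z ∈ G, ⁅x, z⁆ = 0)
    (htr : ∀ m, ∀ z ∈ gr A G (m + 1), (∀ y ∈ A.grading (-1), ⁅y, z⁆ = 0) → z = 0) (m : ℕ) :
    ∀ z ∈ gr A G m, p z = 0 → z = 0 := by
  induction m with
  | zero => exact hinj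
  | succ m ih =>
    intro z hz hpz
    refine htr m z hz fun y hy => ih _ (gr_neg A G h0 h1 m y hy z hz) ?_
    rw [hp, hpz, lie_zero]

theorem inj_gr (E : PositiveExtension k g V W P L A M) (p : N →ₗ[k] M)
    (hp : ∀ (x : L) (z : N), p ⁅x, z⁆ = ⁅x, p z⁆) (hG : G.map p = E.grading 0)
    (hinj : ∀ z ∈ G, p z = 0 → z = 0)
    (h0 : ∀ x ∈ A.grading 0, ∀ z ∈ G, ⁅x, z⁆ ∈ G)
    (h1 : ∀ x ∈ A.grading (-1), ∀ z ∈ G, ⁅x, z⁆ = 0)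
    (htr : ∀ m, ∀ z ∈ gr A G (m + 1), (∀ y ∈ A.grading (-1), ⁅y, z⁆ = 0) → z = 0)
    (z : N) (hz : z ∈ ⨆ m, gr A G m) (hpz : p z = 0) : z = 0 := by
  obtain ⟨f, hf, rfl⟩ := (Submodule.mem_iSup_iff_exists_finsupp _ _).mp hz
  have hind : iSupIndep fun m : ℕ => E.grading (m : ℤ) :=
    E.isInternal.submodule_iSupIndep.comp Nat.cast_injective
  rw [Finsupp.sum, map_sum] at hpz
  have := (iSupIndep_iff_finsetSum_eq_zero_imp_eq_zero _).mp hind f.support (fun i => p (f i))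
    (fun i _ => map_gr G E p hp hG i ▸ Submodule.mem_map_of_mem (hf i)) hpz
  exact Finset.sum_eq_zero fun i hi => inj_gr_hom G p hp hinj h0 h1 htr i _ (hf i) (this i hi)

/-- The projection from the graph is a linear equivalence. -/
theorem bij_gr (E : PositiveExtension k g V W P L A M) (p : N →ₗ[k] M)
    (hp : ∀ (x : L) (z : N), p ⁅x, z⁆ = ⁅x, p z⁆) (hG : G.map p = E.grading 0)
    (hinj : ∀ z ∈ G, p z = 0 → z = 0)
    (h0 : ∀ x ∈ A.grading 0, ∀ z ∈ G, ⁅x, z⁆ ∈ G)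
    (h1 : ∀ x ∈ A.grading (-1), ∀ z ∈ G, ⁅x, z⁆ = 0)
    (htr : ∀ m, ∀ z ∈ gr A G (m + 1), (∀ y ∈ A.grading (-1), ⁅y, z⁆ = 0) → z = 0) :
    Function.Bijective (p ∘ₗ (⨆ m, gr A G m).subtype) := by
  constructor
  · rw [injective_iff_map_eq_zero]
    intro z hz
    exact Subtype.ext (inj_gr G E p hp hG hinj h0 h1 htr z z.2 hz)
  · rw [← LinearMap.range_eq_top, LinearMap.range_comp, Submodule.range_subtype]
    exact surj_gr G E p hp hG

end Graph

end PosExtAux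

/-- Let `(g,ρ,V,𝒱,B₀)` be a standard pentad, `L` its associated graded Lie
algebra, and let `(π̲, U̲) = ⊕_{m≥0} U̲ₘ` be a positively graded `L`-module which is transitive
and generated by `V₀`, `V₁` and `U̲₀`.  Then `U̲` is isomorphic as an `L`-module to the positive
extension of the `g`-module `U̲₀` with respect to `(g,ρ,V,𝒱,B₀)`; in particular, any two such
modules with `g`-equivariantly isomorphic degree-zero parts are isomorphic as `L`-modules, by
an isomorphism extending the given degree-zero isomorphism. -/
theorem statement16
    {k g V W L M M' : Type*} [Field k] [LieRing g] [LieAlgebra k g]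
    [AddCommGroup V] [Module k V] [AddCommGroup W] [Module k W]
    [LieRing L] [LieAlgebra k L]
    [AddCommGroup M] [Module k M] [LieRingModule L M] [LieModule k L M]
    [AddCommGroup M'] [Module k M'] [LieRingModule L M'] [LieModule k L M']
    (P : PentadStruct k g V W)
    (A : AssocGradedLieAlgebra k g V W P L)
    -- `M` is the given transitive, generated, positively graded `L`-module `U̲`
    (E : PositiveExtension k g V W P L A M)
    -- `M'` is the positive extension of the `g`-module `U̲₀`
    (E' : PositiveExtension k g V W P L A M')
    -- whose degree-zero part is `g`-equivariantly isomorphic to `U̲₀`: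
    (e : ↥(E.grading 0) ≃ₗ[k] ↥(E'.grading 0))
    (he : ∀ (a : g) (u : E.grading 0) (h : ⁅A.ιg a, (u : M)⁆ ∈ E.grading 0),
      (e ⟨⁅A.ιg a, (u : M)⁆, h⟩ : M') = ⁅A.ιg a, (e u : M')⁆) :
    ∃ f : M ≃ₗ[k] M',
      (∀ (x : L) (u : M), f ⁅x, u⁆ = ⁅x, f u⁆)
      ∧ (∀ u : E.grading 0, f u = e u) := by
  classical
  let G : Submodule k (M × M') :=
    LinearMap.range ((E.grading 0).subtype.prod ((E'.grading 0).subtype ∘ₗ e.toLinearMap))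
  have hGmem : ∀ z, z ∈ G ↔ ∃ u : E.grading 0, ((u : M), (e u : M')) = z := fun z => Iff.rfl
  have hG1 : G.map (LinearMap.fst k M M') = E.grading 0 := by
    ext w
    constructor
    · rintro ⟨_, ⟨u, rfl⟩, rfl⟩
      exact u.2
    · intro hw
      exact ⟨_, ⟨⟨w, hw⟩, rfl⟩, rfl⟩
  have hG2 : G.map (LinearMap.snd k M M') = E'.grading 0 := by
    ext w
    constructor
    · rintro ⟨_, ⟨u, rfl⟩, rfl⟩
      exact (e u).2
    · intro hw
      exact ⟨_, ⟨e.symm ⟨w, hw⟩, rfl⟩, by simp⟩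
  have hi1 : ∀ z ∈ G, LinearMap.fst k M M' z = 0 → z = 0 := by
    rintro _ ⟨u, rfl⟩ h
    have hu : u = 0 := Subtype.ext h
    rw [hu, map_zero]
  have hi2 : ∀ z ∈ G, LinearMap.snd k M M' z = 0 → z = 0 := by
    rintro _ ⟨u, rfl⟩ h
    have hu : e u = 0 := Subtype.ext h
    have hu : u = 0 := by simpa using hu
    rw [hu, map_zero]
  have h0 : ∀ x ∈ A.grading 0, ∀ z ∈ G, ⁅x, z⁆ ∈ G := by
    intro x hx z hz
    rw [← A.ιg_range] at hx
    obtain ⟨a, rfl⟩ := hx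
    obtain ⟨u, rfl⟩ := (hGmem z).mp hz
    have hmem : ⁅A.ιg a, (u : M)⁆ ∈ E.grading 0 := by
      have ha : A.ιg a ∈ A.grading 0 := A.ιg_range ▸ LinearMap.mem_range_self _ a
      simpa using E.lie_mem 0 0 _ ha _ u.2
    refine (hGmem _).mpr ⟨⟨_, hmem⟩, ?_⟩
    rw [he a u hmem]
    rfl
  have h1 : ∀ x ∈ A.grading (-1), ∀ z ∈ G, ⁅x, z⁆ = 0 := by
    intro x hx z hz
    obtain ⟨u, rfl⟩ := (hGmem z).mp hz
    have ha := E.lie_mem (-1) 0 x hx _ u.2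
    have hb := E'.lie_mem (-1) 0 x hx _ (e u).2
    rw [E.zero_of_neg _ (by norm_num), Submodule.mem_bot] at ha
    rw [E'.zero_of_neg _ (by norm_num), Submodule.mem_bot] at hb
    exact Prod.ext ha hb
  have hp1 : ∀ (x : L) (z : M × M'),
      LinearMap.fst k M M' ⁅x, z⁆ = ⁅x, LinearMap.fst k M M' z⁆ := fun _ _ => rfl
  have hp2 : ∀ (x : L) (z : M × M'),
      LinearMap.snd k M M' ⁅x, z⁆ = ⁅x, LinearMap.snd k M M' z⁆ := fun _ _ => rfl
  have htr : ∀ m, ∀ z ∈ PosExtAux.gr A G (m + 1),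
      (∀ y ∈ A.grading (-1), ⁅y, z⁆ = 0) → z = 0 := by
    intro m z hz h
    have m1 : z.1 ∈ E.grading ((m + 1 : ℕ) : ℤ) :=
      PosExtAux.map_gr G E _ hp1 hG1 (m + 1) ▸ Submodule.mem_map_of_mem hz
    have m2 : z.2 ∈ E'.grading ((m + 1 : ℕ) : ℤ) :=
      PosExtAux.map_gr G E' _ hp2 hG2 (m + 1) ▸ Submodule.mem_map_of_mem hz
    exact Prod.ext
      (E.transitive _ (by lia) _ m1 fun y hy => congrArg Prod.fst (h y hy))
      (E'.transitive _ (by lia) _ m2 fun y hy => congrArg Prod.snd (h y hy))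
  let e1 := LinearEquiv.ofBijective _ (PosExtAux.bij_gr G E _ hp1 hG1 hi1 h0 h1 htr)
  let e2 := LinearEquiv.ofBijective _ (PosExtAux.bij_gr G E' _ hp2 hG2 hi2 h0 h1 htr)
  have hf : ∀ z : M × M', z ∈ (⨆ m, PosExtAux.gr A G m) → (e1.symm.trans e2) z.1 = z.2 := by
    intro z hz
    have : z.1 = e1 ⟨z, hz⟩ := rfl
    rw [this, LinearEquiv.trans_apply, LinearEquiv.symm_apply_apply]
    rfl
  refine ⟨e1.symm.trans e2, ?_, ?_⟩
  · intro x u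
    obtain ⟨⟨z, hz⟩, rfl⟩ := e1.surjective u
    change (e1.symm.trans e2) (⁅x, z⁆ : M × M').1 = ⁅x, (e1.symm.trans e2) z.1⁆
    rw [hf _ hz, hf _ (PosExtAux.iSup_stable A G h0 h1 x z hz)]
    rfl
  · intro u
    exact hf ((u : M), (e u : M')) (Submodule.mem_iSup_of_mem 0 ⟨u, rfl⟩)
end
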